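/- Let (X, μ) be a probability space, let κ be a Markov kernel from X to a measurable space Y, let p₀ be a probability measure on Y, and let p₁ = μ.bind κ be the marginal distribution. Assume that for μ-almost every x the measure κ x is absolutely continuous with respect to p₀. Then ∫ D_KL(κ x ∥ p₀) dμ(x) ≥ ∫ D_KL(κ x ∥ p₁) dμ(x); i.e., among all reference measures, the expected Kullback–Leibler divergence from the conditional law κ x is minimized (and the mutual information is attained) when the reference measure is the marginal p₁, so the MIUB is indeed an upper bound on the mutual information. -/

import Mathlib

open MeasureTheory ProbabilityTheory
open scoped ENNReal Classical

/-- Kullback–Leibler divergence with values in `ℝ≥0∞`: it equals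
`∫ log (dμ/dν) dμ` when `μ ≪ ν` and the integrand is integrable, and `∞` otherwise. -/
noncomputable def klDivE {Y : Type*} [MeasurableSpace Y] (μ ν : Measure Y) : ℝ≥0∞ :=
  if μ ≪ ν ∧ Integrable (fun y => Real.log ((μ.rnDeriv ν y).toReal)) μ then
    ENNReal.ofReal (∫ y, Real.log ((μ.rnDeriv ν y).toReal) ∂μ)
  else ⊤

lemma lintegral_ofReal_neg_llr_lt_top {Y : Type*} [MeasurableSpace Y] (μ ν : Measure Y)
    [IsFiniteMeasure μ] [IsFiniteMeasure ν] (h : μ ≪ ν) :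
    ∫⁻ y, ENNReal.ofReal (-llr μ ν y) ∂μ < ∞ := by
  have hmeas : Measurable fun y => ENNReal.ofReal (-llr μ ν y) :=
    (measurable_llr μ ν).neg.ennreal_ofReal
  rw [← lintegral_rnDeriv_mul h hmeas.aemeasurable]
  calc ∫⁻ y, μ.rnDeriv ν y * ENNReal.ofReal (-llr μ ν y) ∂ν
      ≤ ∫⁻ _, 1 ∂ν := by
        refine lintegral_mono_ae ?_
        filter_upwards [μ.rnDeriv_lt_top ν] with y hy
        rw [← ENNReal.ofReal_toReal hy.ne, ← ENNReal.ofReal_mul ENNReal.toReal_nonneg]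
        refine ENNReal.ofReal_le_one.2 ?_
        have h0 : 0 ≤ (μ.rnDeriv ν y).toReal := ENNReal.toReal_nonneg
        have := InformationTheory.klFun_nonneg h0
        rw [InformationTheory.klFun_apply] at this
        simp only [llr]
        linarith
    _ < ∞ := by simp

lemma integrable_of_lintegral_ofReal_lt_top {Y : Type*} [MeasurableSpace Y] {μ : Measure Y}
    {f : Y → ℝ} (hf : AEStronglyMeasurable f μ) (hpos : ∫⁻ y, ENNReal.ofReal (f y) ∂μ < ∞)
    (hneg : ∫⁻ y, ENNReal.ofReal (-f y) ∂μ < ∞) : Integrable f μ := by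
  refine ⟨hf, ?_⟩
  calc ∫⁻ y, ‖f y‖ₑ ∂μ
      ≤ ∫⁻ y, (ENNReal.ofReal (f y) + ENNReal.ofReal (-f y)) ∂μ := by
        refine lintegral_mono fun y => ?_
        rw [Real.enorm_eq_ofReal_abs]
        rcases abs_cases (f y) with ⟨h, -⟩ | ⟨h, -⟩ <;> simp [h]
    _ = ∫⁻ y, ENNReal.ofReal (f y) ∂μ + ∫⁻ y, ENNReal.ofReal (-f y) ∂μ :=
        lintegral_add_left' hf.aemeasurable.ennreal_ofReal _
    _ < ∞ := ENNReal.add_lt_top.2 ⟨hpos, hneg⟩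

lemma integral_llr_nonneg {Y : Type*} [MeasurableSpace Y] (μ ν : Measure Y)
    [IsProbabilityMeasure μ] [IsProbabilityMeasure ν] (h : μ ≪ ν)
    (hint : Integrable (llr μ ν) μ) : 0 ≤ ∫ y, llr μ ν y ∂μ := by
  simpa using InformationTheory.integral_llr_add_sub_measure_univ_nonneg h hint

lemma lintegral_ofReal_neg_llr_le {Y : Type*} [MeasurableSpace Y] (μ ν : Measure Y)
    [IsProbabilityMeasure μ] [IsProbabilityMeasure ν] (h : μ ≪ ν) :
    ∫⁻ y, ENNReal.ofReal (-llr μ ν y) ∂μ ≤ ∫⁻ y, ENNReal.ofReal (llr μ ν y) ∂μ := by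
  by_cases hpos : ∫⁻ y, ENNReal.ofReal (llr μ ν y) ∂μ = ∞
  · simp [hpos]
  have hneg := lintegral_ofReal_neg_llr_lt_top μ ν h
  have hint := integrable_of_lintegral_ofReal_lt_top
    (measurable_llr μ ν).aestronglyMeasurable (lt_top_iff_ne_top.2 hpos) hneg
  have hnn := integral_llr_nonneg μ ν h hint
  rw [integral_eq_lintegral_pos_part_sub_lintegral_neg_part hint] at hnn
  exact (ENNReal.toReal_le_toReal hneg.ne hpos).1 (sub_nonneg.1 hnn)

lemma llr_eq_add_llr {Y : Type*} [MeasurableSpace Y] (ρ σ τ : Measure Y)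
    [IsFiniteMeasure ρ] [IsFiniteMeasure σ] [IsFiniteMeasure τ] (hρσ : ρ ≪ σ) (hστ : σ ≪ τ) :
    llr ρ τ =ᵐ[ρ] llr ρ σ + llr σ τ := by
  filter_upwards [(hρσ.trans hστ).ae_le (Measure.rnDeriv_mul_rnDeriv (κ := τ) hρσ),
    Measure.rnDeriv_pos hρσ, hρσ.ae_le (ρ.rnDeriv_lt_top σ), hρσ.ae_le (Measure.rnDeriv_pos hστ),
    (hρσ.trans hστ).ae_le (σ.rnDeriv_lt_top τ)] with y hy h1 h2 h3 h4
  have hρ := ENNReal.toReal_pos h1.ne' h2.ne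
  have hσ := ENNReal.toReal_pos h3.ne' h4.ne
  simp only [llr, Pi.add_apply, ← hy, Pi.mul_apply, ENNReal.toReal_mul]
  rw [Real.log_mul hρ.ne' hσ.ne']

/-- Chain rule for a change of reference measure, with the signed term `∫ llr σ τ ∂ρ` split into
its positive and negative parts. -/
lemma klDivE_add_lintegral_llr_le {Y : Type*} [MeasurableSpace Y] (ρ σ τ : Measure Y)
    [IsProbabilityMeasure ρ] [IsProbabilityMeasure σ] [IsProbabilityMeasure τ]
    (hρσ : ρ ≪ σ) (hστ : σ ≪ τ) :
    klDivE ρ σ + ∫⁻ y, ENNReal.ofReal (llr σ τ y) ∂ρ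
      ≤ klDivE ρ τ + ∫⁻ y, ENNReal.ofReal (-llr σ τ y) ∂ρ := by
  by_cases hN : ∫⁻ y, ENNReal.ofReal (-llr σ τ y) ∂ρ = ∞
  · simp [hN]
  by_cases hF : Integrable (llr ρ τ) ρ
  swap
  · have : klDivE ρ τ = ∞ := if_neg fun h => hF h.2
    simp [this]
  have hadd := llr_eq_add_llr ρ σ τ hρσ hστ
  have hP : ∫⁻ y, ENNReal.ofReal (llr σ τ y) ∂ρ < ∞ := by
    calc ∫⁻ y, ENNReal.ofReal (llr σ τ y) ∂ρ
        ≤ ∫⁻ y, (‖llr ρ τ y‖ₑ + ENNReal.ofReal (-llr ρ σ y)) ∂ρ := by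
          refine lintegral_mono_ae ?_
          filter_upwards [hadd] with y hy
          have : llr σ τ y = llr ρ τ y + -llr ρ σ y := by rw [hy, Pi.add_apply]; ring
          rw [this, Real.enorm_eq_ofReal_abs]
          exact ENNReal.ofReal_add_le.trans (by gcongr; exact le_abs_self _)
      _ = ∫⁻ y, ‖llr ρ τ y‖ₑ ∂ρ + ∫⁻ y, ENNReal.ofReal (-llr ρ σ y) ∂ρ :=
          lintegral_add_left (measurable_llr ρ τ).enorm _
      _ < ∞ := ENNReal.add_lt_top.2 ⟨hF.2, lintegral_ofReal_neg_llr_lt_top ρ σ hρσ⟩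
  have hG : Integrable (llr σ τ) ρ := integrable_of_lintegral_ofReal_lt_top
    (measurable_llr σ τ).aestronglyMeasurable hP (lt_top_iff_ne_top.2 hN)
  have hH : Integrable (llr ρ σ) ρ := by
    refine (hF.sub hG).congr ?_
    filter_upwards [hadd] with y hy
    simp [hy]
  have hsum : ∫ y, llr ρ τ y ∂ρ = ∫ y, llr ρ σ y ∂ρ + ∫ y, llr σ τ y ∂ρ := by
    rw [integral_congr_ae hadd]
    exact integral_add hH hG
  have e1 : klDivE ρ σ = ENNReal.ofReal (∫ y, llr ρ σ y ∂ρ) := if_pos ⟨hρσ, hH⟩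
  have e2 : klDivE ρ τ = ENNReal.ofReal (∫ y, llr ρ τ y ∂ρ) := if_pos ⟨hρσ.trans hστ, hF⟩
  have hnσ := integral_llr_nonneg ρ σ hρσ hH
  have hnτ := integral_llr_nonneg ρ τ (hρσ.trans hστ) hF
  have hsplit := integral_eq_lintegral_pos_part_sub_lintegral_neg_part hG
  rw [e1, e2, ← ENNReal.ofReal_toReal hP.ne, ← ENNReal.ofReal_toReal hN,
    ← ENNReal.ofReal_add hnσ ENNReal.toReal_nonneg, ← ENNReal.ofReal_add hnτ ENNReal.toReal_nonneg]
  exact ENNReal.ofReal_le_ofReal (by linarith)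

lemma bind_absolutelyContinuous {X Y : Type*} [MeasurableSpace X] [MeasurableSpace Y]
    (μ : Measure X) (κ : Kernel X Y) (ν : Measure Y) (h : ∀ᵐ x ∂μ, κ x ≪ ν) :
    μ.bind κ ≪ ν := by
  refine Measure.AbsolutelyContinuous.mk fun s hs hνs => ?_
  rw [Measure.bind_apply hs κ.aemeasurable]
  refine lintegral_eq_zero_of_ae_eq_zero ?_
  filter_upwards [h] with x hx using hx hνs

/-- If almost every `κ x` is dominated by one common measure, then so is it by the marginal. -/
lemma ae_absolutelyContinuous_bind {X Y : Type*} [MeasurableSpace X] [MeasurableSpace Y]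
    (μ : Measure X) [IsFiniteMeasure μ] (κ : Kernel X Y) [IsFiniteKernel κ]
    (ν : Measure Y) [IsFiniteMeasure ν] (h : ∀ᵐ x ∂μ, κ x ≪ ν) :
    ∀ᵐ x ∂μ, κ x ≪ μ.bind κ := by
  have hbind := bind_absolutelyContinuous μ κ ν h
  have hpos : ∀ᵐ x ∂μ, ∀ᵐ y ∂κ x, 0 < (μ.bind κ).rnDeriv ν y :=
    Measure.ae_ae_of_ae_bind κ.aemeasurable (Measure.rnDeriv_pos hbind)
  filter_upwards [h, hpos] with x hx hx'
  refine Measure.AbsolutelyContinuous.mk fun s hs hs0 => ?_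
  rw [← Measure.setLIntegral_rnDeriv hbind,
    setLIntegral_eq_zero_iff hs (Measure.measurable_rnDeriv _ _)] at hs0
  refine measure_eq_zero_iff_ae_notMem.2 ?_
  filter_upwards [hx.ae_le hs0, hx'] with y h1 h2 hy
  exact h2.ne' (h1 hy)

/-- **The MIUB is an upper bound on the mutual information.** Among all reference
measures, the expected KL divergence from the conditional law `κ x` is minimized by
the marginal `p₁ = μ.bind κ`:
`∫ D_KL(κ x ∥ p₀) dμ(x) ≥ ∫ D_KL(κ x ∥ p₁) dμ(x) = I(x; y)`. -/
theorem miub_ge_mutualInformation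
    {X Y : Type*} [MeasurableSpace X] [MeasurableSpace Y]
    (μ : Measure X) [IsProbabilityMeasure μ]
    (κ : Kernel X Y) [IsMarkovKernel κ]
    (p₀ : Measure Y) [IsProbabilityMeasure p₀]
    (h_ac : ∀ᵐ x ∂μ, κ x ≪ p₀) :
    ∫⁻ x, klDivE (κ x) (μ.bind (fun x => κ x)) ∂μ ≤ ∫⁻ x, klDivE (κ x) p₀ ∂μ := by
  have hp := bind_absolutelyContinuous μ κ p₀ h_ac
  have hPmeas : Measurable fun y => ENNReal.ofReal (llr (μ.bind κ) p₀ y) :=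
    (measurable_llr _ _).ennreal_ofReal
  have hNmeas : Measurable fun y => ENNReal.ofReal (-llr (μ.bind κ) p₀ y) :=
    (measurable_llr _ _).neg.ennreal_ofReal
  have hle : ∫⁻ x, klDivE (κ x) (μ.bind κ) ∂μ
        + ∫⁻ y, ENNReal.ofReal (llr (μ.bind κ) p₀ y) ∂(μ.bind κ)
      ≤ ∫⁻ x, klDivE (κ x) p₀ ∂μ
        + ∫⁻ y, ENNReal.ofReal (-llr (μ.bind κ) p₀ y) ∂(μ.bind κ) := by
    rw [Measure.lintegral_bind κ.aemeasurable hPmeas.aemeasurable,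
      Measure.lintegral_bind κ.aemeasurable hNmeas.aemeasurable,
      ← lintegral_add_right _ hPmeas.lintegral_kernel,
      ← lintegral_add_right _ hNmeas.lintegral_kernel]
    refine lintegral_mono_ae ?_
    filter_upwards [ae_absolutelyContinuous_bind μ κ p₀ h_ac] with x hx
    exact klDivE_add_lintegral_llr_le _ _ _ hx hp
  refine ENNReal.le_of_add_le_add_right (lintegral_ofReal_neg_llr_lt_top _ _ hp).ne
    (le_trans (add_le_add_right ?_ _) hle)
  exact lintegral_ofReal_neg_llr_le _ _ hp
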